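/- Let ρ₁, ρ₂ and σ be probability measures on X×Y with common second marginal ν, and let ε ∈ [0,1]. Then the squared fibered Wasserstein distance is convex in its first argument along linear interpolation: W_F( (1−ε)ρ₁ + ε ρ₂ , σ )² ≤ (1−ε) W_F(ρ₁, σ)² + ε W_F(ρ₂, σ)². In particular, since W_F is bounded by the diameter of X, W_F( (1−ε)ρ₁ + ε ρ₂ , σ )² ≤ (1−ε) W_F(ρ₁, σ)² + ε (diam X)². -/

import Mathlib

open MeasureTheory ProbabilityTheory Filter Set
open scoped ENNReal Topology

noncomputable section

abbrev Euc (n : ℕ) : Type := EuclideanSpace ℝ (Fin n)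

/-- The set of couplings (transport plans) between two measures. -/
def Couplings {α β : Type*} [MeasurableSpace α] [MeasurableSpace β]
    (μ : Measure α) (ν : Measure β) : Set (Measure (α × β)) :=
  {γ | IsProbabilityMeasure γ ∧ γ.map Prod.fst = μ ∧ γ.map Prod.snd = ν}

/-- Optimal transport cost between two measures for cost `c`. -/
def transportCost {α β : Type*} [MeasurableSpace α] [MeasurableSpace β]
    (c : α → β → ℝ≥0∞) (μ : Measure α) (ν : Measure β) : ℝ≥0∞ :=
  ⨅ γ ∈ Couplings μ ν, ∫⁻ p, c p.1 p.2 ∂γ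

/-- Squared 2-Wasserstein distance. -/
noncomputable def W2sq {α : Type*} [MeasurableSpace α] [PseudoEMetricSpace α]
    (μ ν : Measure α) : ℝ≥0∞ :=
  transportCost (fun a b => edist a b ^ 2) μ ν

/-- `K` is the disintegration of `ρ` with respect to its second marginal `ν`. -/
def IsDisint {α β : Type*} [MeasurableSpace α] [MeasurableSpace β]
    (ν : Measure β) (ρ : Measure (α × β)) (K : Kernel β α) : Prop :=
  IsMarkovKernel K ∧
    ∀ s : Set α, ∀ t : Set β, MeasurableSet s → MeasurableSet t →
      ρ (s ×ˢ t) = ∫⁻ y in t, K y s ∂ν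

/-- Squared fibered Wasserstein distance `W_F(ρ₁,ρ₂)² = ∫_Y W(ρ_{1,y},ρ_{2,y})² dν(y)`. -/
noncomputable def WFsq {α β : Type*} [MeasurableSpace α] [PseudoEMetricSpace α]
    [MeasurableSpace β] (ν : Measure β) (ρ₁ ρ₂ : Measure (α × β)) : ℝ≥0∞ :=
  ⨅ (K₁ : Kernel β α) (K₂ : Kernel β α) (_ : IsDisint ν ρ₁ K₁) (_ : IsDisint ν ρ₂ K₂),
    ∫⁻ y, W2sq (K₁ y) (K₂ y) ∂ν

/-- Two finite measures on a compact metric space agree if they integrate a dense sequence of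
continuous functions equally. -/
lemma measure_eq_of_integral_eq_denseRange {Z ι : Type*} [MetricSpace Z] [CompactSpace Z]
    [MeasurableSpace Z] [BorelSpace Z] {μ ν : Measure Z} [IsFiniteMeasure μ] [IsFiniteMeasure ν]
    {f : ι → C(Z, ℝ)} (hf : DenseRange f) (h : ∀ n, ∫ x, f n x ∂μ = ∫ x, f n x ∂ν) : μ = ν := by
  have hcont : ∀ (m : Measure Z) [IsFiniteMeasure m],
      Continuous fun g : C(Z, ℝ) ↦ ∫ x, g x ∂m := by
    intro m _
    refine (LipschitzWith.of_dist_le_mul (K := (m univ).toNNReal) fun g g' ↦ ?_).continuous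
    have hint : ∀ g : C(Z, ℝ), Integrable g m := fun g ↦
      g.continuous.integrable_of_hasCompactSupport (HasCompactSupport.of_compactSpace g)
    rw [dist_eq_norm, ← integral_sub (hint g) (hint g'), mul_comm]
    refine norm_integral_le_of_norm_le_const (Eventually.of_forall fun x ↦ ?_)
    rw [← dist_eq_norm]
    exact ContinuousMap.dist_apply_le_dist x
  have heq := hf.equalizer (hcont μ) (hcont ν) (funext h)
  refine ext_of_forall_integral_eq_of_IsFiniteMeasure fun g ↦ ?_
  exact congr_fun heq g.toContinuousMap

/-- On a compact metric space, the squared Wasserstein distance between two Markov kernels is a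
measurable function of the parameter. -/
lemma measurable_W2sq_of_compactSpace {β Z : Type*} [MeasurableSpace β] [MetricSpace Z]
    [CompactSpace Z] [MeasurableSpace Z] [BorelSpace Z] (K L : Kernel β Z) [IsMarkovKernel K]
    [IsMarkovKernel L] : Measurable fun y ↦ W2sq (K y) (L y) := by
  obtain ⟨f, hf⟩ := TopologicalSpace.exists_dense_seq C(Z, ℝ)
  let Φ : Measure Z → ℕ → ℝ := fun μ n ↦ ∫ x, f n x ∂μ
  have hΦ : ∀ (J : Kernel β Z) [IsMarkovKernel J], Measurable fun y ↦ Φ (J y) := fun J _ ↦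
    measurable_pi_lambda _ fun n ↦
      ((f n).continuous.stronglyMeasurable.integral_kernel (κ := J)).measurable
  let A : ℝ≥0∞ → Set (ProbabilityMeasure (Z × Z)) := fun q ↦
    {γ | ∫⁻ p, edist p.1 p.2 ^ 2 ∂(γ : Measure (Z × Z)) ≤ q}
  let Ψ : ProbabilityMeasure (Z × Z) → (ℕ → ℝ) × (ℕ → ℝ) := fun γ ↦
    (Φ ((γ : Measure (Z × Z)).map Prod.fst), Φ ((γ : Measure (Z × Z)).map Prod.snd))
  have hA : ∀ q, IsCompact (A q) := by
    intro q
    refine IsClosed.isCompact (isClosed_le ?_ continuous_const)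
    have := ProbabilityMeasure.continuous_lintegral_continuousMap (X := Z × Z)
      (⟨fun p ↦ nndist p.1 p.2 ^ 2, by fun_prop⟩ : C(Z × Z, NNReal))
    simpa only [edist_nndist, ContinuousMap.coe_mk, ENNReal.coe_pow] using this
  have hΨ : Continuous Ψ := by
    have key : ∀ (g : C(Z × Z, Z)),
        Continuous fun γ : ProbabilityMeasure (Z × Z) ↦ Φ ((γ : Measure (Z × Z)).map g) := by
      intro g
      refine continuous_pi fun n ↦ ?_
      have := ProbabilityMeasure.continuous_integral_continuousMap ((f n).comp g)
      refine this.congr fun γ ↦ ?_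
      exact (integral_map g.continuous.aemeasurable
        (f n).continuous.aestronglyMeasurable).symm
    exact (key ⟨Prod.fst, continuous_fst⟩).prodMk (key ⟨Prod.snd, continuous_snd⟩)
  refine measurable_of_Iio fun c ↦ ?_
  have hset : (fun y ↦ W2sq (K y) (L y)) ⁻¹' Iio c =
      ⋃ (q : ℚ) (_ : (Real.toNNReal q : ℝ≥0∞) < c),
        (fun y ↦ (Φ (K y), Φ (L y))) ⁻¹' (Ψ '' A (Real.toNNReal q)) := by
    ext y
    simp only [mem_preimage, mem_Iio, mem_iUnion, W2sq, transportCost, iInf_lt_iff]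
    constructor
    · rintro ⟨γ, ⟨hγ, h1, h2⟩, hlt⟩
      obtain ⟨q, -, hq, hqc⟩ := ENNReal.lt_iff_exists_rat_btwn.1 hlt
      exact ⟨q, hqc, ⟨γ, hγ⟩, hq.le, by simp [Ψ, h1, h2]⟩
    · rintro ⟨q, hqc, γ, hγ, he⟩
      have h1 := Measure.isProbabilityMeasure_map (μ := (γ : Measure (Z × Z)))
        measurable_fst.aemeasurable
      have h2 := Measure.isProbabilityMeasure_map (μ := (γ : Measure (Z × Z)))
        measurable_snd.aemeasurable
      refine ⟨γ, ⟨inferInstance, ?_, ?_⟩, lt_of_le_of_lt hγ hqc⟩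
      · exact measure_eq_of_integral_eq_denseRange hf (congr_fun (congr_arg Prod.fst he))
      · exact measure_eq_of_integral_eq_denseRange hf (congr_fun (congr_arg Prod.snd he))
  rw [hset]
  exact MeasurableSet.iUnion fun q ↦ MeasurableSet.iUnion fun _ ↦
    ((hΦ K).prodMk (hΦ L)) ((hA _).image hΨ).measurableSet

/-- Pushing forward by a map that does not increase distances on a set carrying both measures does
not increase the squared Wasserstein distance. -/
lemma W2sq_map_le {α β : Type*} [MeasurableSpace α] [PseudoEMetricSpace α] [MeasurableSpace β]
    [PseudoEMetricSpace β] {μ ν : Measure α} {S : Set α} (hμ : ∀ᵐ x ∂μ, x ∈ S)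
    (hν : ∀ᵐ x ∂ν, x ∈ S) {f : α → β} (hf : Measurable f)
    (hfS : ∀ x ∈ S, ∀ y ∈ S, edist (f x) (f y) ≤ edist x y) :
    W2sq (μ.map f) (ν.map f) ≤ W2sq μ ν := by
  refine le_iInf₂ fun γ ⟨hγ, h1, h2⟩ ↦ ?_
  have hm : Measurable (Prod.map f f) := hf.prodMap hf
  have hc : γ.map (Prod.map f f) ∈ Couplings (μ.map f) (ν.map f) := by
    refine ⟨Measure.isProbabilityMeasure_map hm.aemeasurable, ?_, ?_⟩
    · rw [Measure.map_map measurable_fst hm, ← h1, Measure.map_map hf measurable_fst]; rfl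
    · rw [Measure.map_map measurable_snd hm, ← h2, Measure.map_map hf measurable_snd]; rfl
  refine (iInf₂_le _ hc).trans ((lintegral_map_le _ _).trans (lintegral_mono_ae ?_))
  rw [← h1] at hμ
  rw [← h2] at hν
  filter_upwards [ae_of_ae_map measurable_fst.aemeasurable hμ,
    ae_of_ae_map measurable_snd.aemeasurable hν] with p hp hq
  exact pow_le_pow_left' (hfS _ hp _ hq) 2

/-- The squared Wasserstein distance between Markov kernels almost surely carried by a compact set
is an almost everywhere measurable function of the parameter. -/
lemma aemeasurable_W2sq {β E : Type*} [MeasurableSpace β] [MetricSpace E] [MeasurableSpace E]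
    [BorelSpace E] {X : Set E} (hX : IsCompact X) (hne : X.Nonempty) {ν : Measure β}
    (K L : Kernel β E) [IsMarkovKernel K] [IsMarkovKernel L]
    (hK : ∀ᵐ y ∂ν, ∀ᵐ x ∂(K y), x ∈ X) (hL : ∀ᵐ y ∂ν, ∀ᵐ x ∂(L y), x ∈ X) :
    AEMeasurable (fun y ↦ W2sq (K y) (L y)) ν := by
  classical
  have := isCompact_iff_compactSpace.1 hX
  obtain ⟨x₀, hx₀⟩ := hne
  let r : E → X := fun x ↦ if h : x ∈ X then ⟨x, h⟩ else ⟨x₀, hx₀⟩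
  have hr : Measurable r :=
    Measurable.dite (s := X) measurable_id measurable_const hX.measurableSet
  have hrX : ∀ x ∈ X, (r x : E) = x := fun x hx ↦ by simp [r, hx]
  have := Kernel.IsMarkovKernel.map K hr
  have := Kernel.IsMarkovKernel.map L hr
  refine ⟨_, measurable_W2sq_of_compactSpace (K.map r) (L.map r), ?_⟩
  have hback : ∀ μ : Measure E, (∀ᵐ x ∂μ, x ∈ X) → (μ.map r).map Subtype.val = μ := by
    intro μ hμ
    rw [Measure.map_map measurable_subtype_coe hr]
    refine (Measure.map_congr ?_).trans Measure.map_id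
    filter_upwards [hμ] with x hx using hrX x hx
  filter_upwards [hK, hL] with y hKy hLy
  rw [Kernel.map_apply _ hr, Kernel.map_apply _ hr]
  refine le_antisymm ?_ (W2sq_map_le hKy hLy hr fun x hx x' hx' ↦ ?_)
  · conv_lhs => rw [← hback _ hKy, ← hback _ hLy]
    exact W2sq_map_le (S := univ) (by simp) (by simp) measurable_subtype_coe
      fun _ _ _ _ ↦ le_rfl
  · rw [Subtype.edist_eq, hrX x hx, hrX x' hx']

lemma W2sq_convex {α : Type*} [MeasurableSpace α] [PseudoEMetricSpace α] (μ₁ μ₂ ν : Measure α)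
    {a b : ℝ≥0∞} (hab : a + b = 1) (ha : a ≠ 0) (hb : b ≠ 0) :
    W2sq (a • μ₁ + b • μ₂) ν ≤ a * W2sq μ₁ ν + b * W2sq μ₂ ν := by
  have ha' : a ≠ ∞ := fun h ↦ by simp [h] at hab
  have hb' : b ≠ ∞ := fun h ↦ by simp [h] at hab
  simp only [W2sq, transportCost, ENNReal.mul_iInf_of_ne ha ha', ENNReal.mul_iInf_of_ne hb hb']
  refine ENNReal.le_iInf₂_add_iInf₂ fun γ₁ ⟨hγ₁, h11, h12⟩ γ₂ ⟨hγ₂, h21, h22⟩ ↦ ?_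
  have hc : a • γ₁ + b • γ₂ ∈ Couplings (a • μ₁ + b • μ₂) ν := by
    refine ⟨⟨by simp [hab]⟩, ?_, ?_⟩
    · simp [Measure.map_add _ _ measurable_fst, h11, h21]
    · rw [Measure.map_add _ _ measurable_snd, Measure.map_smul, Measure.map_smul, h12, h22,
        ← add_smul, hab, one_smul]
  refine (iInf₂_le _ hc).trans_eq ?_
  rw [lintegral_add_measure, lintegral_smul_measure, lintegral_smul_measure]; rfl

lemma W2sq_le_diam_sq {α : Type*} [MeasurableSpace α] [PseudoEMetricSpace α] {μ ν : Measure α}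
    [IsProbabilityMeasure μ] [IsProbabilityMeasure ν] {S : Set α} (hμ : ∀ᵐ x ∂μ, x ∈ S)
    (hν : ∀ᵐ x ∂ν, x ∈ S) : W2sq μ ν ≤ Metric.ediam S ^ 2 := by
  refine (iInf₂_le (μ.prod ν) ⟨inferInstance, by simp, by simp⟩).trans ?_
  calc ∫⁻ p, edist p.1 p.2 ^ 2 ∂(μ.prod ν) ≤ ∫⁻ _, Metric.ediam S ^ 2 ∂(μ.prod ν) := by
        refine lintegral_mono_ae ?_
        filter_upwards [Measure.quasiMeasurePreserving_fst.ae hμ,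
          Measure.quasiMeasurePreserving_snd.ae hν] with p hp hq
        gcongr
        exact Metric.edist_le_ediam_of_mem hp hq
    _ = Metric.ediam S ^ 2 := by simp

namespace IsDisint

variable {α β : Type*} [MeasurableSpace α] [MeasurableSpace β] {ν : Measure β}
  {ρ ρ₁ ρ₂ : Measure (α × β)} {K L K₁ K₂ : Kernel β α}

lemma map_swap_eq_compProd [IsProbabilityMeasure ν] [IsProbabilityMeasure ρ]
    (h : IsDisint ν ρ K) : ρ.map Prod.swap = ν ⊗ₘ K := by
  have := h.1
  have := Measure.isProbabilityMeasure_map (μ := ρ) measurable_swap.aemeasurable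
  refine Measure.ext_prod fun {t s} ht hs ↦ ?_
  rw [Measure.map_apply measurable_swap (ht.prod hs), preimage_swap_prod, h.2 s t hs ht,
    Measure.compProd_apply_prod ht hs]

lemma ae_eq [MeasurableSpace.CountableOrCountablyGenerated β α] [IsProbabilityMeasure ν]
    [IsProbabilityMeasure ρ] (hK : IsDisint ν ρ K) (hL : IsDisint ν ρ L) : K =ᵐ[ν] L := by
  have := hK.1
  have := hL.1
  exact Kernel.ae_eq_of_compProd_eq (hK.map_swap_eq_compProd.symm.trans hL.map_swap_eq_compProd)

lemma ae_ae_mem [IsProbabilityMeasure ν] [IsProbabilityMeasure ρ] (hK : IsDisint ν ρ K)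
    {X : Set α} (hX : MeasurableSet X) (hρ : ∀ᵐ p ∂ρ, p.1 ∈ X) :
    ∀ᵐ y ∂ν, ∀ᵐ x ∂(K y), x ∈ X := by
  have := hK.2 Xᶜ univ hX.compl MeasurableSet.univ
  rw [Measure.restrict_univ, measure_mono_null _ (ae_iff.1 hρ)] at this
  · exact (lintegral_eq_zero_iff (K.measurable_coe hX.compl)).1 this.symm
  · exact fun p hp ↦ hp.1

lemma exists_isDisint [StandardBorelSpace α] [Nonempty α] [IsProbabilityMeasure ρ]
    (hρ : ρ.map Prod.snd = ν) : ∃ K : Kernel β α, IsDisint ν ρ K := by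
  have := Measure.isProbabilityMeasure_map (μ := ρ) measurable_swap.aemeasurable
  have hfst : (ρ.map Prod.swap).fst = ν := by rw [Measure.fst_map_swap, ← hρ]; rfl
  refine ⟨(ρ.map Prod.swap).condKernel, inferInstance, fun s t hs ht ↦ ?_⟩
  have := (ρ.map Prod.swap).disintegrate (ρ.map Prod.swap).condKernel
  rw [hfst] at this
  have hν : IsProbabilityMeasure ν := hfst ▸ inferInstance
  rw [← Measure.compProd_apply_prod ht hs, this,
    Measure.map_apply measurable_swap (ht.prod hs), preimage_swap_prod]

/-- A convex combination of disintegrations disintegrates the convex combination. -/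
lemma exists_convexComb (h₁ : IsDisint ν ρ₁ K₁) (h₂ : IsDisint ν ρ₂ K₂) {a b : ℝ≥0∞}
    (hab : a + b = 1) : ∃ K : Kernel β α, IsDisint ν (a • ρ₁ + b • ρ₂) K ∧
      ∀ y, K y = a • K₁ y + b • K₂ y := by
  have := h₁.1
  have := h₂.1
  refine ⟨⟨fun y ↦ a • K₁ y + b • K₂ y, ?_⟩, ⟨⟨fun y ↦ ⟨?_⟩⟩, fun s t hs ht ↦ ?_⟩, fun _ ↦ rfl⟩
  · refine Measure.measurable_of_measurable_coe _ fun s hs ↦ ?_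
    simp only [Measure.add_apply, Measure.smul_apply, smul_eq_mul]
    exact ((K₁.measurable_coe hs).const_mul a).add ((K₂.measurable_coe hs).const_mul b)
  · simp [hab]
  · simp only [Measure.add_apply, Measure.smul_apply, smul_eq_mul, Kernel.coe_mk]
    rw [h₁.2 s t hs ht, h₂.2 s t hs ht,
      lintegral_add_left ((K₁.measurable_coe hs).const_mul a),
      lintegral_const_mul _ (K₁.measurable_coe hs), lintegral_const_mul _ (K₂.measurable_coe hs)]

end IsDisint

/-- The fibered distance may be computed with any choice of disintegrations. -/
lemma WFsq_eq_lintegral {α β : Type*} [MeasurableSpace α] [PseudoEMetricSpace α]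
    [MeasurableSpace β] [MeasurableSpace.CountableOrCountablyGenerated β α] {ν : Measure β}
    {ρ σ : Measure (α × β)} [IsProbabilityMeasure ν] [IsProbabilityMeasure ρ]
    [IsProbabilityMeasure σ] {K L : Kernel β α} (hK : IsDisint ν ρ K) (hL : IsDisint ν σ L) :
    WFsq ν ρ σ = ∫⁻ y, W2sq (K y) (L y) ∂ν := by
  refine le_antisymm (iInf₂_le_of_le K L (iInf₂_le hK hL)) ?_
  refine le_iInf₂ fun K' L' ↦ le_iInf₂ fun hK' hL' ↦ (lintegral_congr_ae ?_).le
  filter_upwards [hK.ae_eq hK', hL.ae_eq hL'] with y h h'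
  rw [h, h']

lemma WFsq_convex {E β : Type*} [MetricSpace E] [MeasurableSpace E] [BorelSpace E]
    [StandardBorelSpace E] [MeasurableSpace β] {X : Set E} (hX : IsCompact X) (hne : X.Nonempty)
    {ν : Measure β} {ρ₁ ρ₂ σ : Measure (E × β)} [IsProbabilityMeasure ν]
    [IsProbabilityMeasure ρ₁] [IsProbabilityMeasure ρ₂] [IsProbabilityMeasure σ]
    (hρ₁ : ρ₁.map Prod.snd = ν) (hρ₂ : ρ₂.map Prod.snd = ν) (hσ : σ.map Prod.snd = ν)
    (hρ₁X : ∀ᵐ p ∂ρ₁, p.1 ∈ X) (hσX : ∀ᵐ p ∂σ, p.1 ∈ X) {a b : ℝ≥0∞} (hab : a + b = 1) :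
    WFsq ν (a • ρ₁ + b • ρ₂) σ ≤ a * WFsq ν ρ₁ σ + b * WFsq ν ρ₂ σ := by
  rcases eq_or_ne a 0 with rfl | ha
  · obtain rfl : b = 1 := by simpa using hab
    simp
  rcases eq_or_ne b 0 with rfl | hb
  · obtain rfl : a = 1 := by simpa using hab
    simp
  have ha' : a ≠ ∞ := fun h ↦ by simp [h] at hab
  have hb' : b ≠ ∞ := fun h ↦ by simp [h] at hab
  have : Nonempty E := hne.to_subtype.map Subtype.val
  obtain ⟨K₁, hK₁⟩ := IsDisint.exists_isDisint hρ₁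
  obtain ⟨K₂, hK₂⟩ := IsDisint.exists_isDisint hρ₂
  obtain ⟨L, hL⟩ := IsDisint.exists_isDisint hσ
  obtain ⟨K, hK, hKeq⟩ := hK₁.exists_convexComb hK₂ hab
  have : IsProbabilityMeasure (a • ρ₁ + b • ρ₂) := ⟨by simp [hab]⟩
  have := hK₁.1
  have := hL.1
  have hmeas : AEMeasurable (fun y ↦ W2sq (K₁ y) (L y)) ν :=
    aemeasurable_W2sq hX hne K₁ L (hK₁.ae_ae_mem hX.measurableSet hρ₁X)
      (hL.ae_ae_mem hX.measurableSet hσX)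
  rw [WFsq_eq_lintegral hK hL, WFsq_eq_lintegral hK₁ hL, WFsq_eq_lintegral hK₂ hL,
    ← lintegral_const_mul' _ _ ha', ← lintegral_const_mul' _ _ hb',
    ← lintegral_add_left' (hmeas.const_mul a)]
  refine lintegral_mono fun y ↦ ?_
  rw [hKeq]
  exact W2sq_convex _ _ _ hab ha hb

lemma WFsq_le_diam_sq {E β : Type*} [PseudoEMetricSpace E] [MeasurableSpace E]
    [StandardBorelSpace E] [Nonempty E] [MeasurableSpace β] {X : Set E} (hX : MeasurableSet X)
    {ν : Measure β} {ρ σ : Measure (E × β)} [IsProbabilityMeasure ν]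
    [IsProbabilityMeasure ρ] [IsProbabilityMeasure σ]
    (hρ : ρ.map Prod.snd = ν) (hσ : σ.map Prod.snd = ν)
    (hρX : ∀ᵐ p ∂ρ, p.1 ∈ X) (hσX : ∀ᵐ p ∂σ, p.1 ∈ X) :
    WFsq ν ρ σ ≤ Metric.ediam X ^ 2 := by
  obtain ⟨K, hK⟩ := IsDisint.exists_isDisint hρ
  obtain ⟨L, hL⟩ := IsDisint.exists_isDisint hσ
  have := hK.1
  have := hL.1
  calc WFsq ν ρ σ = ∫⁻ y, W2sq (K y) (L y) ∂ν := WFsq_eq_lintegral hK hL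
    _ ≤ ∫⁻ _, Metric.ediam X ^ 2 ∂ν := by
        refine lintegral_mono_ae ?_
        filter_upwards [hK.ae_ae_mem hX hρX, hL.ae_ae_mem hX hσX] with y h h'
        exact W2sq_le_diam_sq h h'
    _ = Metric.ediam X ^ 2 := by simp

/-- convexity of the squared fibered Wasserstein distance in its first argument
along linear interpolation, and the resulting bound
`W_F((1−ε)ρ₁ + ερ₂, σ)² ≤ (1−ε) W_F(ρ₁,σ)² + ε (diam X)²`. -/
theorem stmt14 {d d' : ℕ} (X : Set (Euc d)) (Y : Set (Euc d'))
    (hX : IsCompact X) (hXne : X.Nonempty) (hY : IsCompact Y) (hYne : Y.Nonempty)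
    (ν : Measure (Euc d')) [IsProbabilityMeasure ν] (hνY : ν Yᶜ = 0)
    (ρ₁ ρ₂ σ : Measure (Euc d × Euc d'))
    [IsProbabilityMeasure ρ₁] [IsProbabilityMeasure ρ₂] [IsProbabilityMeasure σ]
    (hρ₁supp : ρ₁ ((X ×ˢ Y)ᶜ) = 0) (hρ₂supp : ρ₂ ((X ×ˢ Y)ᶜ) = 0)
    (hσsupp : σ ((X ×ˢ Y)ᶜ) = 0)
    (hρ₁marg : ρ₁.map Prod.snd = ν) (hρ₂marg : ρ₂.map Prod.snd = ν)
    (hσmarg : σ.map Prod.snd = ν)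
    (ε : ℝ) (hε0 : 0 ≤ ε) (hε1 : ε ≤ 1) :
    WFsq ν (ENNReal.ofReal (1 - ε) • ρ₁ + ENNReal.ofReal ε • ρ₂) σ
        ≤ ENNReal.ofReal (1 - ε) * WFsq ν ρ₁ σ + ENNReal.ofReal ε * WFsq ν ρ₂ σ
      ∧ WFsq ν (ENNReal.ofReal (1 - ε) • ρ₁ + ENNReal.ofReal ε • ρ₂) σ
        ≤ ENNReal.ofReal (1 - ε) * WFsq ν ρ₁ σ + ENNReal.ofReal ε * EMetric.diam X ^ 2 := by
  have hfst : ∀ ρ : Measure (Euc d × Euc d'), ρ ((X ×ˢ Y)ᶜ) = 0 → ∀ᵐ p ∂ρ, p.1 ∈ X :=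
    fun ρ h ↦ (show ∀ᵐ p ∂ρ, p ∈ X ×ˢ Y from h).mono fun p hp ↦ hp.1
  have hab : ENNReal.ofReal (1 - ε) + ENNReal.ofReal ε = 1 := by
    rw [← ENNReal.ofReal_add (by linarith) hε0]
    simp
  have hconv := WFsq_convex hX hXne hρ₁marg hρ₂marg hσmarg (hfst _ hρ₁supp) (hfst _ hσsupp) hab
  refine ⟨hconv, hconv.trans ?_⟩
  gcongr
  exact WFsq_le_diam_sq hX.measurableSet hρ₂marg hσmarg (hfst _ hρ₂supp) (hfst _ hσsupp)


end
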